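/- arXiv:2207.01563 — 2 statements merged into one kernel-verified Lean document; each statement's English description precedes it below -/
import Mathlib

section
/- Let n ≥ 1 and let M be an n×n symmetric integer matrix that is negative definite (vᵀMv < 0 for every nonzero v ∈ ℤⁿ). If m ∈ ℤⁿ has all entries ≤ 0 and m ≠ 0, then there exist an integer K ≥ 1 and a sequence v⁰ = m, v¹, …, v^K = 0 in ℤⁿ such that for each t < K there is an index i_t with v^{t+1} = v^t + e_{i_t} (e_{i_t} the standard basis vector), v^t_{i_t} < 0, and (M·v^t)_{i_t} > 0. -/
/-- Auxiliary chain lemma, by induction on the negated sum of the entries. -/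
theorem chain_aux (n : ℕ) (M : Matrix (Fin n) (Fin n) ℤ)
    (hnegdef : ∀ v : Fin n → ℤ, v ≠ 0 → dotProduct v (M.mulVec v) < 0) (k : ℕ) :
    ∀ m : Fin n → ℤ, (∀ i, m i ≤ 0) → -∑ i, m i = (k : ℤ) →
    ∃ (v : ℕ → (Fin n → ℤ)),
      v 0 = m ∧ v k = 0 ∧
      ∀ t < k, ∃ i : Fin n,
        v (t + 1) = v t + Pi.single i (1 : ℤ) ∧
        v t i < 0 ∧ 0 < (M.mulVec (v t)) i := by
  induction k with
  | zero =>
    intro m hm hs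
    refine ⟨fun _ => m, rfl, ?_, by simp⟩
    have h0 : ∑ i, m i = 0 := by simpa using hs
    have := (Finset.sum_eq_zero_iff_of_nonpos (fun i _ => hm i)).1 h0
    funext i
    exact this i (Finset.mem_univ i)
  | succ k ih =>
    intro m hm hs
    have hm0 : m ≠ 0 := by
      rintro rfl
      simp at hs
      omega
    obtain ⟨i, -, hi⟩ : ∃ i ∈ Finset.univ, m i * M.mulVec m i < 0 := by
      by_contra! hc
      exact absurd (hnegdef m hm0) (not_lt.2 (Finset.sum_nonneg hc))
    have hpos : 0 < M.mulVec m i := by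
      by_contra! hc
      exact absurd hi (not_lt.2 (mul_nonneg_of_nonpos_of_nonpos (hm i) hc))
    have hneg : m i < 0 := by
      rcases (hm i).lt_or_eq with h | h
      · exact h
      · simp [h] at hi
    obtain ⟨v, h0, hk, hv⟩ := ih (m + Pi.single i 1) (by
      intro j
      by_cases h : j = i
      · subst h
        simp
        omega
      · simpa [h] using hm j) (by
      simp [Finset.sum_add_distrib]
      push_cast at hs
      omega)
    refine ⟨fun t => Nat.casesOn t m v, rfl, hk, ?_⟩
    rintro (_ | t) ht
    · exact ⟨i, h0, hneg, hpos⟩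
    · exact hv t (by omega)

/-- Let `M` be an `n × n` symmetric negative definite integer matrix.
If `m ∈ ℤⁿ` has all entries `≤ 0` and `m ≠ 0`, then there is a finite sequence
`v 0 = m, v 1, …, v K = 0` such that at each step one adds a standard basis vector
`e i` at an index `i` where the current vector is negative and `(M·vᵗ) i > 0`. -/
theorem exists_increasing_chain_to_zero
    (n : ℕ) (hn : 1 ≤ n) (M : Matrix (Fin n) (Fin n) ℤ)
    (hsymm : M.IsSymm)
    (hnegdef : ∀ v : Fin n → ℤ, v ≠ 0 → dotProduct v (M.mulVec v) < 0)
    (m : Fin n → ℤ) (hm : ∀ i, m i ≤ 0) (hm0 : m ≠ 0) :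
    ∃ (K : ℕ) (_ : 1 ≤ K) (v : ℕ → (Fin n → ℤ)),
      v 0 = m ∧ v K = 0 ∧
      ∀ t < K, ∃ i : Fin n,
        v (t + 1) = v t + Pi.single i (1 : ℤ) ∧
        v t i < 0 ∧ 0 < (M.mulVec (v t)) i := by
  have hs : ∑ i, m i ≤ 0 := Finset.sum_nonpos (fun i _ => hm i)
  obtain ⟨k, hk⟩ := Int.eq_ofNat_of_zero_le (neg_nonneg.2 hs)
  obtain ⟨v, h0, h1, h2⟩ := chain_aux n M hnegdef k m hm hk
  refine ⟨k, ?_, v, h0, h1, h2⟩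
  rcases Nat.eq_zero_or_pos k with rfl | h
  · exact absurd (h0.symm.trans h1) hm0
  · exact h
end

section
/- Let Y be a topological space, U and V open subsets with Y = U ∪ V, and G a sheaf of abelian groups on Y such that the first sheaf cohomology groups H¹(U, G|_U) and H¹(V, G|_V) vanish (sheaf cohomology defined as the right derived functor of the global sections functor on the abelian category of sheaves of abelian groups). Then there is an exact sequence 0 → G(Y) → G(U) ⊕ G(V) → G(U ∩ V) → H¹(Y, G) → 0, where the first map is the pair of restrictions, the second map is the difference of the restrictions from U and from V to U ∩ V, and the third map realizes H¹(Y, G) as the cokernel; in particular H¹(Y, G) is isomorphic to the cokernel of G(U) ⊕ G(V) → G(U ∩ V). -/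
open CategoryTheory TopologicalSpace Opposite Limits

/-- The sections functor `Γ(U, -)` on an open set `U` of a topological space `Y`,
on the category of sheaves of abelian groups on `Y`, is additive. -/
instance sectionsFunctor_additive (Y : TopCat.{0}) (U : Opens Y) :
    ((sheafSections (Opens.grothendieckTopology Y) AddCommGrpCat.{0}).obj (op U)).Additive :=
  ⟨rfl⟩

/-- Sheaf cohomology `Hⁿ(U, G)` of a sheaf of abelian groups `G` on a topological space
`Y`, over an open subset `U ⊆ Y`: the `n`-th right derived functor of the sections
functor `Γ(U, -)` (for `U = ⊤` this is the right derived functor of global sections;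
for a general open `U` it computes the cohomology `Hⁿ(U, G|_U)` of the restriction). -/
noncomputable def sheafCohomology (Y : TopCat.{0})
    [EnoughInjectives (Sheaf (Opens.grothendieckTopology Y) AddCommGrpCat.{0})]
    (n : ℕ) (U : Opens Y) :
    Sheaf (Opens.grothendieckTopology Y) AddCommGrpCat.{0} ⥤ AddCommGrpCat.{0} :=
  ((sheafSections (Opens.grothendieckTopology Y) AddCommGrpCat).obj (op U)).rightDerived n


theorem mvAux_flasque (Y : TopCat.{0})
    (I : Sheaf (Opens.grothendieckTopology Y) AddCommGrpCat.{0}) [Injective I]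
    {W U : Opens Y} (i : W ⟶ U) (s : I.obj.obj (op W)) :
    ∃ t : I.obj.obj (op U), I.obj.map i.op t = s := by
  let A := (AddCommGrpCat.adj.{0}.whiskerRight (Opens Y)ᵒᵖ).comp
    (sheafificationAdjunction (Opens.grothendieckTopology Y) AddCommGrpCat.{0})
  let m := (presheafToSheaf (Opens.grothendieckTopology Y) AddCommGrpCat.{0}).map
    (Functor.whiskerRight (yoneda.map i) AddCommGrpCat.free)
  have hm : Mono m := by dsimp only [m]; infer_instance
  let f := (A.homEquiv (yoneda.obj W) I).symm (yonedaEquiv.symm s)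
  let g := Injective.factorThru f m
  have hg : m ≫ g = f := Injective.comp_factorThru f m
  refine ⟨yonedaEquiv (A.homEquiv (yoneda.obj U) I g), ?_⟩
  have h1 := A.homEquiv_naturality_left (yoneda.map i) g
  have h2 : A.homEquiv (yoneda.obj W) I f = yonedaEquiv.symm s := by simp [f]
  have h3 := yonedaEquiv_naturality (A.homEquiv (yoneda.obj U) I g) i
  refine h3.trans ?_
  rw [← h1]
  refine (congrArg (fun z => yonedaEquiv (A.homEquiv (yoneda.obj W) I z)) hg).trans ?_
  rw [h2]
  exact (yonedaEquiv (F := I.obj ⋙ forget AddCommGrpCat)).apply_symm_apply s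

theorem mvAux_glue (Y : TopCat.{0}) (U V : Opens Y) (hUV : U ⊔ V = ⊤)
    (G : Sheaf (Opens.grothendieckTopology Y) AddCommGrpCat.{0})
    (a : G.obj.obj (op U)) (b : G.obj.obj (op V))
    (h : G.obj.map (homOfLE (inf_le_left : U ⊓ V ≤ U)).op a =
            G.obj.map (homOfLE (inf_le_right : U ⊓ V ≤ V)).op b) :
    ∃ s : G.obj.obj (op (⊤ : Opens Y)),
            G.obj.map (homOfLE (le_top : U ≤ ⊤)).op s = a ∧
            G.obj.map (homOfLE (le_top : V ≤ ⊤)).op s = b := by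
  let S := Opens.mayerVietorisSquare' (T := Y)
    { X₁ := U ⊓ V
      X₂ := U
      X₃ := V
      X₄ := ⊤
      f₁₂ := homOfLE inf_le_left
      f₁₃ := homOfLE inf_le_right
      f₂₄ := homOfLE le_top
      f₃₄ := homOfLE le_top
      fac := Subsingleton.elim _ _ } hUV.symm rfl
  have hS : S.SheafCondition (G.obj ⋙ forget _) :=
    (S.sheafCondition_of_sheaf G).map (forget AddCommGrpCat)
  exact ⟨hS.glue a b h, hS.map_f₂₄_op_glue a b h, hS.map_f₃₄_op_glue a b h⟩

theorem mvAux_ext (Y : TopCat.{0}) (U V : Opens Y) (hUV : U ⊔ V = ⊤)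
    (G : Sheaf (Opens.grothendieckTopology Y) AddCommGrpCat.{0})
    (s t : G.obj.obj (op (⊤ : Opens Y)))
    (h1 : G.obj.map (homOfLE (le_top : U ≤ ⊤)).op s = G.obj.map (homOfLE (le_top : U ≤ ⊤)).op t)
    (h2 : G.obj.map (homOfLE (le_top : V ≤ ⊤)).op s = G.obj.map (homOfLE (le_top : V ≤ ⊤)).op t) :
    s = t :=
  TopCat.Sheaf.eq_of_locally_eq₂ (X := Y) G (homOfLE (le_top : U ≤ ⊤)) (homOfLE (le_top : V ≤ ⊤))
    hUV.ge s t h1 h2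

theorem mvAux_sc (S : ShortComplex AddCommGrpCat.{0}) (H : AddCommGrpCat.{0})
    (i : H ≅ S.homology) :
    ∃ π : S.g.hom.ker →+ H, Function.Surjective π ∧ ∀ x, π x = 0 ↔ ∃ y, S.f y = x.1 := by
  let N : AddSubgroup S.g.hom.ker := S.abToCycles.range
  let e' : H ≃+ (S.g.hom.ker ⧸ N) := (i ≪≫ S.abHomologyIso).addCommGroupIsoToAddEquiv
  refine ⟨e'.symm.toAddMonoidHom.comp (QuotientAddGroup.mk' N),
    e'.symm.surjective.comp (QuotientAddGroup.mk'_surjective _), ?_⟩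
  intro x
  change e'.symm (QuotientAddGroup.mk' N x) = 0 ↔ _
  rw [map_eq_zero_iff e'.symm e'.symm.injective, QuotientAddGroup.mk'_apply,
    QuotientAddGroup.eq_zero_iff, AddMonoidHom.mem_range]
  exact exists_congr fun y => Subtype.ext_iff

theorem mvAux_H1 {C : Type*} [Category C] [Abelian C] [EnoughInjectives C] {G : C}
    (I : InjectiveResolution G) (F : C ⥤ AddCommGrpCat.{0}) [F.Additive] :
    ∃ π : (F.map (I.cocomplex.d 1 2)).hom.ker →+ (F.rightDerived 1).obj G,
      Function.Surjective π ∧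
      ∀ x, π x = 0 ↔ ∃ y, F.map (I.cocomplex.d 0 1) y = x.1 :=
  mvAux_sc (((F.mapHomologicalComplex (ComplexShape.up ℕ)).obj I.cocomplex).sc' 0 1 2) _
    (I.isoRightDerivedObj F 1 ≪≫
      ShortComplex.homologyMapIso (HomologicalComplex.isoSc' _ 0 1 2 (by simp) (by simp)))

theorem mvAux_kernel {C : Type*} [Category C] [Abelian C] {G : C}
    (I : InjectiveResolution G) :
    ∃ ι : G ⟶ I.cocomplex.X 0, ∀ (F : C ⥤ AddCommGrpCat.{0}) [F.Additive]
      [PreservesFiniteLimits F], Function.Injective (F.map ι) ∧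
      ∀ x, F.map (I.cocomplex.d 0 1) x = 0 ↔ ∃ y, F.map ι y = x := by
  refine ⟨I.ι.f 0, fun F _ _ => ?_⟩
  let S : ShortComplex C := ShortComplex.mk _ _ I.ι_f_zero_comp_complex_d
  have h := (S.map F).exact_and_mono_f_iff_f_is_kernel.2
    ⟨KernelFork.mapIsLimit _ I.isLimitKernelFork F⟩
  exact ⟨(AddCommGrpCat.mono_iff_injective _).1 h.2,
    (S.map F).ab_exact_iff_function_exact.1 h.1⟩

theorem mvAux_hom {A B : Type*} [AddCommGroup A] [AddCommGroup B] (R : A → B → Prop)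
    (tot : ∀ a, ∃ b, R a b) (sub : ∀ a b a' b', R a b → R a' b' → R (a - a') (b - b'))
    (hadd : ∀ a b a' b', R a b → R a' b' → R (a + a') (b + b'))
    (zero : ∀ b, R 0 b → b = 0) : ∃ f : A →+ B, ∀ a b, R a b ↔ f a = b := by
  choose f hf using tot
  have uniq : ∀ a b, R a b → f a = b := fun a b h => by
    have := zero (f a - b) (by simpa using sub _ _ _ _ (hf a) h)
    exact sub_eq_zero.1 this
  refine ⟨AddMonoidHom.mk' f fun x y => uniq _ _ (hadd _ _ _ _ (hf x) (hf y)), fun a b =>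
    ⟨uniq a b, ?_⟩⟩
  rintro rfl
  exact hf a

theorem mvAux_main (Y : TopCat.{0}) (U V : Opens Y) (hUV : U ⊔ V = ⊤)
    (G I0 I1 I2 : Sheaf (Opens.grothendieckTopology Y) AddCommGrpCat.{0}) [Injective I0]
    (ι : G ⟶ I0) (d0 : I0 ⟶ I1) (d1 : I1 ⟶ I2)
    (hι : ∀ W, Function.Injective (ι.hom.app (op W)))
    (hk : ∀ W x, d0.hom.app (op W) x = 0 ↔ ∃ y, ι.hom.app (op W) y = x)
    (hd : ∀ W x, d1.hom.app (op W) (d0.hom.app (op W) x) = 0)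
    (hU : ∀ x, d1.hom.app (op U) x = 0 → ∃ y, d0.hom.app (op U) y = x)
    (hV : ∀ x, d1.hom.app (op V) x = 0 → ∃ y, d0.hom.app (op V) y = x)
    (H : AddCommGrpCat.{0}) (π : (d1.hom.app (op ⊤)).hom.ker →+ H)
    (hπ : Function.Surjective π)
    (hπ0 : ∀ x, π x = 0 ↔ ∃ y, d0.hom.app (op ⊤) y = x.1) :
    ∃ δ : G.obj.obj (op (U ⊓ V)) ⟶ H,
      (∀ t : G.obj.obj (op (U ⊓ V)), δ t = 0 ↔
        ∃ (a : G.obj.obj (op U)) (b : G.obj.obj (op V)),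
          G.obj.map (homOfLE (inf_le_left : U ⊓ V ≤ U)).op a -
              G.obj.map (homOfLE (inf_le_right : U ⊓ V ≤ V)).op b = t) ∧
      Function.Surjective δ := by
  -- naturality of sheaf morphisms on sections
  have nat : ∀ {A B : Sheaf (Opens.grothendieckTopology Y) AddCommGrpCat.{0}} (f : A ⟶ B)
      {W W' : Opens Y} (i : W ⟶ W') (x : A.obj.obj (op W')),
      f.hom.app (op W) (A.obj.map i.op x) = B.obj.map i.op (f.hom.app (op W') x) :=
    fun f _ _ i x => NatTrans.naturality_apply f.hom i.op x
  have resres : ∀ (A : Sheaf (Opens.grothendieckTopology Y) AddCommGrpCat.{0})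
      (x : A.obj.obj (op ⊤)),
      A.obj.map (homOfLE (inf_le_left : U ⊓ V ≤ U)).op
        (A.obj.map (homOfLE (le_top : U ≤ ⊤)).op x) =
      A.obj.map (homOfLE (inf_le_right : U ⊓ V ≤ V)).op
        (A.obj.map (homOfLE (le_top : V ≤ ⊤)).op x) := fun A x => by
    rw [← ConcreteCategory.comp_apply, ← ConcreteCategory.comp_apply, ← A.obj.map_comp,
      ← A.obj.map_comp]
    rfl
  let iU := homOfLE (inf_le_left : U ⊓ V ≤ U)
  let iV := homOfLE (inf_le_right : U ⊓ V ≤ V)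
  let jU := homOfLE (le_top : U ≤ ⊤)
  let jV := homOfLE (le_top : V ≤ ⊤)
  -- the connecting relation
  let R : G.obj.obj (op (U ⊓ V)) → H → Prop := fun t h =>
    ∃ (a : I0.obj.obj (op U)) (b : I0.obj.obj (op V)) (c : (d1.hom.app (op ⊤)).hom.ker),
      I0.obj.map iU.op a - I0.obj.map iV.op b = ι.hom.app _ t ∧
      I1.obj.map jU.op c.1 = d0.hom.app _ a ∧ I1.obj.map jV.op c.1 = d0.hom.app _ b ∧ π c = h
  have closed : ∀ a b, I0.obj.map iU.op a - I0.obj.map iV.op b ∈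
      Set.range (ι.hom.app (op (U ⊓ V))) ↔
      I1.obj.map iU.op (d0.hom.app _ a) = I1.obj.map iV.op (d0.hom.app _ b) := fun a b => by
    rw [Set.mem_range, ← hk, map_sub, sub_eq_zero, nat, nat]
  have zeroAux : ∀ t h, R t h → (h = 0 ↔ ∃ (a : G.obj.obj (op U)) (b : G.obj.obj (op V)),
          G.obj.map iU.op a - G.obj.map iV.op b = t) := by
    rintro t _ ⟨a, b, c, hab, hcU, hcV, rfl⟩
    rw [hπ0]
    constructor
    · rintro ⟨e, he⟩
      obtain ⟨a', ha'⟩ := (hk U (a - I0.obj.map jU.op e)).1 (by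
        rw [map_sub, nat, he, hcU, sub_self])
      obtain ⟨b', hb'⟩ := (hk V (b - I0.obj.map jV.op e)).1 (by
        rw [map_sub, nat, he, hcV, sub_self])
      refine ⟨a', b', hι _ ?_⟩
      rw [map_sub, nat, nat, ha', hb', map_sub, map_sub, ← hab, resres I0 e]
      abel
    · rintro ⟨a', b', rfl⟩
      rw [map_sub, nat, nat, sub_eq_sub_iff_sub_eq_sub, ← map_sub, ← map_sub] at hab
      obtain ⟨e, heU, heV⟩ := mvAux_glue Y U V hUV I0 _ _ hab
      have z : ∀ W x, d0.hom.app (op W) (ι.hom.app (op W) x) = 0 := fun W x => (hk W _).2 ⟨x, rfl⟩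
      refine ⟨e, mvAux_ext Y U V hUV I1 _ _ ?_ ?_⟩
      · rw [← nat, heU, map_sub, z, sub_zero]; exact hcU.symm
      · rw [← nat, heV, map_sub, z, sub_zero]; exact hcV.symm
  have mkc : ∀ (c : I1.obj.obj (op ⊤)) (a : I0.obj.obj (op U)) (b : I0.obj.obj (op V)),
      I1.obj.map jU.op c = d0.hom.app _ a → I1.obj.map jV.op c = d0.hom.app _ b →
      d1.hom.app (op ⊤) c = 0 := fun c a b h1 h2 => by
    apply mvAux_ext Y U V hUV I2
    · rw [← nat, map_zero, ← hd U a]; exact congrArg _ h1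
    · rw [← nat, map_zero, ← hd V b]; exact congrArg _ h2
  obtain ⟨f, hf⟩ := mvAux_hom R (fun t => by
      obtain ⟨a, ha⟩ := mvAux_flasque Y I0 iU (ι.hom.app _ t)
      have hab : I0.obj.map iU.op a - I0.obj.map iV.op 0 = ι.hom.app _ t := by
        rw [map_zero, sub_zero, ha]
      obtain ⟨c, hc1, hc2⟩ := mvAux_glue Y U V hUV I1 _ _ ((closed a 0).1 ⟨t, hab.symm⟩)
      exact ⟨_, a, 0, ⟨c, mkc c a 0 hc1 hc2⟩, hab, hc1, hc2, rfl⟩)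
    (by
      rintro t _ t' _ ⟨a, b, c, h1, h2, h3, rfl⟩ ⟨a', b', c', h1', h2', h3', rfl⟩
      refine ⟨a - a', b - b', c - c', ?_, ?_, ?_, map_sub _ _ _⟩
      · rw [map_sub, map_sub, map_sub, ← h1, ← h1']; abel
      · rw [AddSubgroup.coe_sub, map_sub, map_sub, h2, h2']
      · rw [AddSubgroup.coe_sub, map_sub, map_sub, h3, h3'])
    (by
      rintro t _ t' _ ⟨a, b, c, h1, h2, h3, rfl⟩ ⟨a', b', c', h1', h2', h3', rfl⟩
      refine ⟨a + a', b + b', c + c', ?_, ?_, ?_, map_add _ _ _⟩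
      · rw [map_add, map_add, map_add, ← h1, ← h1']; abel
      · rw [AddSubgroup.coe_add, map_add, map_add, h2, h2']
      · rw [AddSubgroup.coe_add, map_add, map_add, h3, h3'])
    (fun h hR => (zeroAux 0 h hR).2 ⟨0, 0, by rw [map_zero, map_zero, sub_zero]⟩)
  refine ⟨AddCommGrpCat.ofHom f, fun t => zeroAux t (f t) ((hf _ _).2 rfl), fun h => ?_⟩
  obtain ⟨c, rfl⟩ := hπ h
  have hc : d1.hom.app (op ⊤) c.1 = 0 := c.2
  obtain ⟨a, ha⟩ := hU (I1.obj.map jU.op c.1) (by rw [nat, hc, map_zero])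
  obtain ⟨b, hb⟩ := hV (I1.obj.map jV.op c.1) (by rw [nat, hc, map_zero])
  obtain ⟨t, ht⟩ := (closed a b).2 (by rw [ha, hb]; exact resres I1 c.1)
  exact ⟨t, (hf _ _).1 ⟨a, b, c, ht.symm, ha.symm, hb.symm, rfl⟩⟩

/-- Mayer–Vietoris for `H¹` with two opens.  Let `Y = U ∪ V` be a
topological space covered by two open subsets and `G` a sheaf of abelian groups on `Y`
with `H¹(U, G|_U) = H¹(V, G|_V) = 0`.  Then the sequence
`0 → G(Y) → G(U) ⊕ G(V) → G(U ∩ V) → H¹(Y, G) → 0` is exact, where the first map is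
the pair of restrictions, the second the difference of restrictions, and the third map
realizes `H¹(Y, G)` as the cokernel. -/
theorem mayerVietoris_two_opens_H1
    (Y : TopCat.{0})
    [EnoughInjectives (Sheaf (Opens.grothendieckTopology Y) AddCommGrpCat.{0})]
    (U V : Opens Y) (hUV : U ⊔ V = ⊤)
    (G : Sheaf (Opens.grothendieckTopology Y) AddCommGrpCat.{0})
    (hU : IsZero ((sheafCohomology Y 1 U).obj G))
    (hV : IsZero ((sheafCohomology Y 1 V).obj G)) :
    ∃ δ : G.val.obj (op (U ⊓ V)) ⟶ (sheafCohomology Y 1 ⊤).obj G,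
      -- exactness at `G(Y)`: the pair of restrictions is injective
      Function.Injective (fun s : G.val.obj (op (⊤ : Opens Y)) =>
        (G.val.map (homOfLE (le_top : U ≤ ⊤)).op s,
          G.val.map (homOfLE (le_top : V ≤ ⊤)).op s)) ∧
      -- exactness at `G(U) ⊕ G(V)`
      (∀ (a : G.val.obj (op U)) (b : G.val.obj (op V)),
        G.val.map (homOfLE (inf_le_left : U ⊓ V ≤ U)).op a =
            G.val.map (homOfLE (inf_le_right : U ⊓ V ≤ V)).op b ↔
          ∃ s : G.val.obj (op (⊤ : Opens Y)),
            G.val.map (homOfLE (le_top : U ≤ ⊤)).op s = a ∧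
            G.val.map (homOfLE (le_top : V ≤ ⊤)).op s = b) ∧
      -- exactness at `G(U ∩ V)`
      (∀ t : G.val.obj (op (U ⊓ V)), δ t = 0 ↔
        ∃ (a : G.val.obj (op U)) (b : G.val.obj (op V)),
          G.val.map (homOfLE (inf_le_left : U ⊓ V ≤ U)).op a -
              G.val.map (homOfLE (inf_le_right : U ⊓ V ≤ V)).op b = t) ∧
      -- exactness at `H¹(Y, G)`: `δ` is surjective, so `H¹(Y, G)` is the cokernel
      Function.Surjective δ := by
  let I := injectiveResolution G
  let F := fun W : Opens Y =>
    (sheafSections (Opens.grothendieckTopology Y) AddCommGrpCat.{0}).obj (op W)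
  have : ∀ W, PreservesFiniteLimits (F W) := fun W => by
    have : PreservesFiniteLimits (sheafToPresheaf (Opens.grothendieckTopology Y)
      AddCommGrpCat.{0} ⋙ (evaluation _ _).obj (op W)) := inferInstance
    exact this
  obtain ⟨ι, hι⟩ := mvAux_kernel (injectiveResolution G)
  obtain ⟨π, hπ, hπ0⟩ := mvAux_H1 (injectiveResolution G) (F ⊤)
  have van : ∀ W, IsZero ((sheafCohomology Y 1 W).obj G) → ∀ x,
      (F W).map ((injectiveResolution G).cocomplex.d 1 2) x = 0 →
      ∃ y, (F W).map ((injectiveResolution G).cocomplex.d 0 1) y = x := fun W hW x hx => by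
    obtain ⟨π, hπ, hπ0⟩ := mvAux_H1 (injectiveResolution G) (F W)
    have hs : Subsingleton ((sheafCohomology Y 1 W).obj G) :=
      AddCommGrpCat.subsingleton_of_isZero hW
    exact (hπ0 ⟨x, hx⟩).1 (hs.elim _ _)
  obtain ⟨δ, h1, h2⟩ := mvAux_main Y U V hUV G _ _ _ ι _ _ (fun W => (hι (F W)).1)
    (fun W => (hι (F W)).2) (fun W x => by
      have := (injectiveResolution G).cocomplex.d_comp_d 0 1 2
      have h := congrArg (fun m => (F W).map m x) this
      exact h) (van U hU) (van V hV) _ π hπ hπ0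
  refine ⟨δ, fun s t h => ?_, fun a b => ⟨mvAux_glue Y U V hUV G a b, ?_⟩, h1, h2⟩
  · exact mvAux_ext Y U V hUV G s t (congrArg Prod.fst h) (congrArg Prod.snd h)
  · rintro ⟨s, rfl, rfl⟩
    rw [← ConcreteCategory.comp_apply, ← ConcreteCategory.comp_apply, ← Functor.map_comp,
      ← Functor.map_comp]
    rfl
end
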